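/- For every odd integer k ≥ 1, the dilate k·Δ_2^0 contains no point of ℤ³, whereas there exists K such that for every odd integer k ≥ K the dilate k·Δ'_2 contains at least one point of ℤ³. Consequently Δ_2^0 and Δ'_2 are not Ehrhart-equivalent. -/

import Mathlib

open Pointwise

/-- A unimodular transformation of `ℝ^n`: an affine map `x ↦ A·x + b` with
`A ∈ GL_n(ℤ)` and `b ∈ ℤ^n`. -/
def IsUnimodular {n : ℕ} (f : (Fin n → ℝ) → (Fin n → ℝ)) : Prop :=
  ∃ A : Matrix (Fin n) (Fin n) ℤ, IsUnit A.det ∧ ∃ b : Fin n → ℤ,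
    ∀ x, f x = (A.map (Int.cast : ℤ → ℝ)).mulVec x + fun i => (b i : ℝ)

/-- `conv(0, e_1, …, e_i)` in `ℝ^n`, where `e_1, …, e_n` is the standard basis. -/
def baseSimplex (n i : ℕ) : Set (Fin n → ℝ) :=
  convexHull ℝ (insert 0 ((fun j : Fin n => (Pi.single j 1 : Fin n → ℝ)) '' {j | (j : ℕ) < i}))

/-- A half-unimodular simplex: a set `Δ` such that `2Δ` is the image of some
`conv(0, e_1, …, e_i)` under a unimodular transformation. -/
def IsHalfUnimodular {n : ℕ} (Δ : Set (Fin n → ℝ)) : Prop :=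
  ∃ i ≤ n, ∃ f, IsUnimodular f ∧ (2 : ℝ) • Δ = f '' baseSimplex n i

/-- The number of lattice points in a subset of `ℝ^n`. -/
noncomputable def latticeCount {n : ℕ} (S : Set (Fin n → ℝ)) : ℕ :=
  Set.ncard {x : Fin n → ℤ | (fun i => (x i : ℝ)) ∈ S}

/-- `Δ_i^1 = ½·conv(0, e_1, …, e_i)` in `ℝ^n`. -/
noncomputable def Δone (n i : ℕ) : Set (Fin n → ℝ) := (2⁻¹ : ℝ) • baseSimplex n i

/-- `Δ_i^0 = ½·conv(e_1, …, e_{i+1})` in `ℝ^n`. -/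
noncomputable def Δzero (n i : ℕ) : Set (Fin n → ℝ) :=
  (2⁻¹ : ℝ) •
    convexHull ℝ ((fun j : Fin n => (Pi.single j 1 : Fin n → ℝ)) '' {j | (j : ℕ) < i + 1})

/-- `Δ'_2 = (½,½,0) + ½·conv(0, e_1, e_2)` in `ℝ³`. -/
noncomputable def Δ'two : Set (Fin 3 → ℝ) := (![1/2, 1/2, 0] : Fin 3 → ℝ) +ᵥ Δone 3 2

/-- `Δ'_3 = (½,½,0) + ½·conv(0, e_1, e_2, e_3)` in `ℝ³`. -/
noncomputable def Δ'three : Set (Fin 3 → ℝ) := (![1/2, 1/2, 0] : Fin 3 → ℝ) +ᵥ Δone 3 3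

/-- Points of the convex hull of some standard basis vectors have coordinate sum `1`. -/
theorem sum_eq_one_of_mem_convexHull_single {n : ℕ} {s : Set (Fin n)} {x : Fin n → ℝ}
    (hx : x ∈ convexHull ℝ ((fun j : Fin n => (Pi.single j 1 : Fin n → ℝ)) '' s)) :
    ∑ i, x i = 1 := by
  refine convexHull_min (t := {y : Fin n → ℝ | ∑ i, y i = 1}) ?_ ?_ hx
  · rintro _ ⟨j, -, rfl⟩
    simp
  · intro y hy z hz a b _ _ hab
    simp only [Set.mem_ofPred_eq] at hy hz ⊢
    simp [Finset.sum_add_distrib, ← Finset.mul_sum, hy, hz, hab]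

theorem mem_baseSimplex_three_two {x : Fin 3 → ℝ} :
    x ∈ baseSimplex 3 2 ↔ 0 ≤ x 0 ∧ 0 ≤ x 1 ∧ x 0 + x 1 ≤ 1 ∧ x 2 = 0 := by
  constructor
  · intro hx
    refine convexHull_min
      (t := {y : Fin 3 → ℝ | 0 ≤ y 0 ∧ 0 ≤ y 1 ∧ y 0 + y 1 ≤ 1 ∧ y 2 = 0}) ?_ ?_ hx
    · rintro _ (rfl | ⟨j, hj, rfl⟩)
      · simp
      · fin_cases j <;> simp_all
    · rintro y ⟨hy0, hy1, hy, hy2⟩ z ⟨hz0, hz1, hz, hz2⟩ a b ha hb hab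
      simp only [Set.mem_ofPred_eq, Pi.add_apply, Pi.smul_apply, smul_eq_mul]
      refine ⟨by positivity, by positivity, ?_, by simp [hy2, hz2]⟩
      nlinarith [mul_le_mul_of_nonneg_left hy ha, mul_le_mul_of_nonneg_left hz hb]
  · rintro ⟨h0, h1, h, h2⟩
    have key := (convex_convexHull ℝ (insert 0
      ((fun j : Fin 3 => (Pi.single j 1 : Fin 3 → ℝ)) '' {j | (j : ℕ) < 2}))).sum_mem
      (t := Finset.univ) (w := ![1 - x 0 - x 1, x 0, x 1])
      (z := ![0, Pi.single 0 1, Pi.single 1 1])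
      (by intro i _; fin_cases i <;> simp <;> linarith)
      (by simp [Fin.sum_univ_three]; ring)
      (by
        intro i _
        apply subset_convexHull
        fin_cases i
        · exact Or.inl rfl
        · exact Or.inr ⟨0, by simp, rfl⟩
        · exact Or.inr ⟨1, by simp, rfl⟩)
    have hx : x = ∑ i : Fin 3, (![1 - x 0 - x 1, x 0, x 1] : Fin 3 → ℝ) i •
        (![0, Pi.single 0 1, Pi.single 1 1] : Fin 3 → Fin 3 → ℝ) i := by
      ext i
      fin_cases i <;> simp [Fin.sum_univ_three, h2]
    rw [hx]
    exact key

theorem mem_smul_Δ'two {k : ℝ} (hk : 0 < k) {x : Fin 3 → ℝ} :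
    x ∈ k • Δ'two ↔ k ≤ 2 * x 0 ∧ k ≤ 2 * x 1 ∧ 2 * (x 0 + x 1) ≤ 3 * k ∧ x 2 = 0 := by
  rw [Set.mem_smul_set_iff_inv_smul_mem₀ hk.ne', Δ'two, Δone, Set.mem_vadd_set_iff_neg_vadd_mem,
    Set.mem_smul_set_iff_inv_smul_mem₀ (by norm_num), mem_baseSimplex_three_two]
  have h (t : ℝ) : k⁻¹ * t = t / k := by field_simp
  simp only [vadd_eq_add, Pi.smul_apply, Pi.add_apply, Pi.neg_apply, smul_eq_mul, inv_inv, h,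
    Matrix.cons_val]
  refine and_congr ?_ (and_congr ?_ (and_congr ?_ ?_))
  · rw [show 2 * (-(1 / 2) + x 0 / k) = (2 * x 0 - k) / k by field_simp; ring,
      le_div_iff₀ hk, zero_mul, sub_nonneg]
  · rw [show 2 * (-(1 / 2) + x 1 / k) = (2 * x 1 - k) / k by field_simp; ring,
      le_div_iff₀ hk, zero_mul, sub_nonneg]
  · rw [show 2 * (-(1 / 2) + x 0 / k) + 2 * (-(1 / 2) + x 1 / k)
      = (2 * (x 0 + x 1) - 2 * k) / k by field_simp; ring, div_le_iff₀ hk]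
    constructor <;> intro h <;> linarith
  · simp [hk.ne']

/-- Odd dilates of `Δ_i^0` contain no lattice point: the coordinate sum would be `k / 2`. -/
theorem intCast_notMem_smul_Δzero {n i k : ℕ} (hk : Odd k) (x : Fin n → ℤ) :
    (fun j => (x j : ℝ)) ∉ (k : ℝ) • Δzero n i := by
  rintro ⟨_, ⟨y, hy, rfl⟩, hxy⟩
  have hsum : ∑ j, (x j : ℝ) = k * 2⁻¹ := by
    calc ∑ j, (x j : ℝ) = ∑ j, ((k : ℝ) • (2⁻¹ : ℝ) • y) j :=
          Finset.sum_congr rfl fun j _ => (congrFun hxy j).symm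
      _ = k * 2⁻¹ := by
          simp [← Finset.mul_sum, sum_eq_one_of_mem_convexHull_single hy]
  have h2 : 2 * ∑ j, x j = (k : ℤ) := by
    have : 2 * ∑ j, (x j : ℝ) = k := by rw [hsum]; ring
    exact_mod_cast this
  obtain ⟨m, rfl⟩ := hk
  push_cast at h2
  omega

theorem latticeCount_three_smul_Δ'two : latticeCount ((3 : ℝ) • Δ'two) = 1 := by
  rw [latticeCount, Set.ncard_eq_one]
  refine ⟨![2, 2, 0], ?_⟩
  ext x
  simp only [Set.mem_ofPred_eq, Set.mem_singleton_iff, mem_smul_Δ'two (by norm_num : (0 : ℝ) < 3)]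
  constructor
  · rintro ⟨h0, h1, h, h2⟩
    norm_cast at h0 h1 h h2
    ext i
    fin_cases i <;> simp <;> omega
  · rintro rfl
    norm_num
    rfl

/-- For odd `k ≥ 1`, `k·Δ_2^0` contains no lattice point, while `k·Δ'_2` contains a lattice
point for all sufficiently large odd `k`; consequently `Δ_2^0` and `Δ'_2` are not
Ehrhart-equivalent. -/
theorem Δzero_two_not_ehrhart_equivalent_Δ'two :
    (∀ k : ℕ, Odd k → ∀ x : Fin 3 → ℤ, (fun i => (x i : ℝ)) ∉ (k : ℝ) • Δzero 3 2) ∧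
    (∃ K : ℕ, ∀ k : ℕ, Odd k → K ≤ k →
      ∃ x : Fin 3 → ℤ, (fun i => (x i : ℝ)) ∈ (k : ℝ) • Δ'two) ∧
    ¬ (∀ k : ℕ, 1 ≤ k →
        latticeCount ((k : ℝ) • Δzero 3 2) = latticeCount ((k : ℝ) • Δ'two)) := by
  refine ⟨fun k hk x => intCast_notMem_smul_Δzero hk x, ⟨3, ?_⟩, fun h => ?_⟩
  · rintro k ⟨m, rfl⟩ hm
    refine ⟨![m + 1, m + 1, 0], (mem_smul_Δ'two (by positivity)).2 ?_⟩
    have : (1 : ℝ) ≤ m := by exact_mod_cast (by omega : 1 ≤ m)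
    simp only [Matrix.cons_val]
    push_cast
    refine ⟨by linarith, by linarith, by linarith, rfl⟩
  · have h3 := h 3 (by norm_num)
    have h0 : latticeCount (((3 : ℕ) : ℝ) • Δzero 3 2) = 0 := by
      simp [latticeCount, intCast_notMem_smul_Δzero (by decide : Odd 3), -Nat.cast_ofNat]
    rw [h0, Nat.cast_ofNat, latticeCount_three_smul_Δ'two] at h3
    exact zero_ne_one h3
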